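/- arXiv:2601.21243 — 3 statements merged into one kernel-verified Lean document; each statement's English description precedes it below -/
import Mathlib

section
/- Let f : 2^{[n]} × ℝ^m → ℝ be submodular with respect to its first variable and concave with respect to its second variable, let f^L(x,y) = ∫₀¹ f(S_τ(x), y) dτ be its Lovász extension in the first variable, let Y ⊂ ℝ^m be a nonempty convex compact set, and set ζ(x) = max_{y ∈ Y} f^L(x,y) for x ∈ [0,1]^n. If ζ is itself the Lovász extension of a submodular function, i.e., there exists a submodular g : 2^{[n]} → ℝ with ζ(x) = ∫₀¹ g(S_τ(x)) dτ for all x ∈ [0,1]^n, then min_{x ∈ [0,1]^n} max_{y ∈ Y} f^L(x,y) = min_{x ∈ {0,1}^n} max_{y ∈ Y} f^L(x,y), and consequently max_{y ∈ Y} min_{S ⊆ [n]} f(S,y) = min_{S ⊆ [n]} max_{y ∈ Y} f(S,y), so a saddle point of f exists. -/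
open MeasureTheory Finset

/-- The Lovász extension of `f : 2^{[n]} × ℝ^m → ℝ` in its first variable:
`f^L(x,y) = ∫₀¹ f(S_τ(x), y) dτ` where `S_τ(x) = {i : x_i > τ}`. -/
noncomputable def lovasz {n : ℕ} {α : Type*} (f : Finset (Fin n) → α → ℝ)
    (x : Fin n → ℝ) (y : α) : ℝ :=
  ∫ τ in (0:ℝ)..1, f (Finset.univ.filter fun i => τ < x i) y

/-- The set of vertices `{0,1}^n` of the hypercube `[0,1]^n`. -/
def vertices (n : ℕ) : Set (Fin n → ℝ) := {x | ∀ i, x i = 0 ∨ x i = 1}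

theorem aux_greedy {n : ℕ} (h : Finset (Fin n) → ℝ)
    (hs : ∀ S T : Finset (Fin n), h (S ∩ T) + h (S ∪ T) ≤ h S + h T)
    (x : Fin n → ℝ) :
    ∃ w : Fin n → ℝ, (∀ S : Finset (Fin n), h ∅ + ∑ i ∈ S, w i ≤ h S) ∧
      ∀ τ : ℝ, h ∅ + ∑ i ∈ (Finset.univ.filter fun i => τ < x i), w i
        = h (Finset.univ.filter fun i => τ < x i) := by
  classical
  let k : Fin n → ℝ ×ₗ Fin n := fun i => toLex (-x i, i)
  have hk : Function.Injective k := by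
    intro a b hab
    have h1 := congrArg (fun z => (ofLex z).2) hab
    simpa [k] using h1
  let C : Fin n → Finset (Fin n) := fun i => Finset.univ.filter fun j => k j < k i
  let w : Fin n → ℝ := fun i => h (insert i (C i)) - h (C i)
  have key : ∀ S : Finset (Fin n), (h ∅ + ∑ i ∈ S, w i ≤ h S) ∧
      ((∀ i ∈ S, ∀ j, k j ≤ k i → j ∈ S) → h ∅ + ∑ i ∈ S, w i = h S) := by
    intro S
    induction S using Finset.induction_on_max_value k with
    | empty => simp
    | insert a T ha hmax ih =>
      have hlt : ∀ j ∈ T, k j < k a := by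
        intro j hj
        refine lt_of_le_of_ne (hmax j hj) ?_
        intro hh
        exact ha (hk hh ▸ hj)
      have hTC : T ⊆ C a := by
        intro j hj
        simp [C, hlt j hj]
      have haC : a ∉ C a := by simp [C]
      rw [Finset.sum_insert ha]
      constructor
      · have h1 := hs (insert a T) (C a)
        have e1 : insert a T ∩ C a = T := by
          rw [Finset.insert_inter_of_notMem haC]
          exact Finset.inter_eq_left.mpr hTC
        have e2 : insert a T ∪ C a = insert a (C a) := by
          rw [Finset.insert_union, Finset.union_eq_right.mpr hTC]
        rw [e1, e2] at h1
        have := ih.1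
        simp only [w] at this ⊢
        linarith
      · intro hlow
        have eT : T = C a := by
          apply Finset.Subset.antisymm hTC
          intro j hj
          have hj' : k j < k a := by simpa [C] using hj
          have := hlow a (Finset.mem_insert_self _ _) j hj'.le
          rcases Finset.mem_insert.mp this with rfl | h2
          · exact absurd hj' (lt_irrefl _)
          · exact h2
        have hl : ∀ i ∈ T, ∀ j, k j ≤ k i → j ∈ T := by
          intro i hi j hj
          rw [eT]
          simp only [C, Finset.mem_filter, Finset.mem_univ, true_and]
          exact lt_of_le_of_lt hj (hlt i hi)
        have h3 := ih.2 hl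
        have h4 : w a = h (insert a T) - h T := by
          simp only [w]; rw [← eT]
        linarith
  refine ⟨w, fun S => (key S).1, fun τ => (key _).2 ?_⟩
  intro i hi j hj
  simp only [Finset.mem_filter, Finset.mem_univ, true_and] at hi ⊢
  have : -x j ≤ -x i := by
    have := Prod.Lex.monotone_fst _ _ hj
    simpa [k] using this
  linarith

theorem aux_ii (c w : ℝ) : IntervalIntegrable (fun τ : ℝ => if τ < c then w else 0) volume 0 1 := by
  have : (fun τ : ℝ => if τ < c then w else 0) = Set.indicator (Set.Iio c) (fun _ => w) := by
    ext τ; simp [Set.indicator]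
  rw [this, intervalIntegrable_iff]
  exact (integrableOn_const (by simp)).indicator measurableSet_Iio

theorem aux_sum {n : ℕ} (x w : Fin n → ℝ) :
    IntervalIntegrable (fun τ : ℝ => ∑ i, if τ < x i then w i else 0) volume 0 1 := by
  have := IntervalIntegrable.sum (μ := volume) (a := (0:ℝ)) (b := 1) Finset.univ
    (f := fun i τ => if τ < x i then w i else 0) (fun i _ => aux_ii (x i) (w i))
  have e : (fun τ : ℝ => ∑ i, if τ < x i then w i else 0)
      = ∑ i, fun τ : ℝ => if τ < x i then w i else 0 := by
    funext τ
    rw [Finset.sum_apply]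
  rw [e]
  exact this

theorem aux_int (c w : ℝ) (h0 : 0 ≤ c) (h1 : c ≤ 1) :
    ∫ τ in (0:ℝ)..1, (if τ < c then w else 0) = w * c := by
  have e : ∫ τ in (0:ℝ)..1, (if τ < c then w else 0)
      = ∫ τ in (0:ℝ)..1, Set.indicator {τ | τ ≤ c} (fun _ => w) τ := by
    apply intervalIntegral.integral_congr_ae
    have : ∀ᵐ τ : ℝ, τ ≠ c := by simp [ae_iff]
    filter_upwards [this] with τ hτ _
    simp [Set.indicator, le_iff_lt_or_eq, hτ]
  rw [e, intervalIntegral.integral_indicator ⟨h0, h1⟩]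
  simp [mul_comm]

theorem aux_main {n : ℕ} (h : Finset (Fin n) → ℝ)
    (hs : ∀ S T : Finset (Fin n), h (S ∩ T) + h (S ∪ T) ≤ h S + h T)
    (x : Fin n → ℝ) (hx : x ∈ Set.Icc (0 : Fin n → ℝ) 1) :
    ∃ w : Fin n → ℝ, (∀ S : Finset (Fin n), h ∅ + ∑ i ∈ S, w i ≤ h S) ∧
      (∀ τ : ℝ, h ∅ + ∑ i ∈ (Finset.univ.filter fun i => τ < x i), w i
        = h (Finset.univ.filter fun i => τ < x i)) ∧
      ∫ τ in (0:ℝ)..1, h (Finset.univ.filter fun i => τ < x i) = h ∅ + ∑ i, w i * x i := by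
  obtain ⟨w, h1, h2⟩ := aux_greedy h hs x
  refine ⟨w, h1, h2, ?_⟩
  simp_rw [← h2, Finset.sum_filter]
  rw [intervalIntegral.integral_add (by simp)
    (aux_sum x w),
    intervalIntegral.integral_finsetSum (fun i _ => aux_ii (x i) (w i))]
  congr 1
  · simp
  · exact Finset.sum_congr rfl fun i _ => aux_int _ _ (hx.1 i) (hx.2 i)

theorem aux_lower {n : ℕ} (h : Finset (Fin n) → ℝ)
    (hs : ∀ S T : Finset (Fin n), h (S ∩ T) + h (S ∪ T) ≤ h S + h T)
    (x : Fin n → ℝ) (c : ℝ) (hc : ∀ S, c ≤ h S) :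
    c ≤ ∫ τ in (0:ℝ)..1, h (Finset.univ.filter fun i => τ < x i) := by
  obtain ⟨w, h1, h2⟩ := aux_greedy h hs x
  have hint : IntervalIntegrable (fun τ : ℝ => h (Finset.univ.filter fun i => τ < x i))
      volume 0 1 := by
    simp_rw [← h2, Finset.sum_filter]
    exact IntervalIntegrable.add (by simp) (aux_sum x w)
  have := intervalIntegral.integral_mono (μ := volume) (a := (0:ℝ)) (b := 1)
    (f := fun _ => c) zero_le_one (by simp) hint (fun τ => hc _)
  simpa using this

noncomputable def auxInd {n : ℕ} (S : Finset (Fin n)) : Fin n → ℝ := fun i => if i ∈ S then 1 else 0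

theorem aux_vertex {n : ℕ} (h : Finset (Fin n) → ℝ)
    (hs : ∀ S T : Finset (Fin n), h (S ∩ T) + h (S ∪ T) ≤ h S + h T) (S : Finset (Fin n)) :
    ∫ τ in (0:ℝ)..1, h (Finset.univ.filter fun i => τ < auxInd S i) = h S := by
  have hx : auxInd S ∈ Set.Icc (0 : Fin n → ℝ) 1 := by
    constructor <;> intro i <;> simp only [auxInd] <;> split_ifs <;> simp
  obtain ⟨w, -, h2, h3⟩ := aux_main h hs _ hx
  have e : (Finset.univ.filter fun i => (1/2:ℝ) < auxInd S i) = S := by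
    ext i
    rw [Finset.mem_filter]
    by_cases hi : i ∈ S
    · simp only [auxInd, hi, if_true, Finset.mem_univ, true_and, iff_true]
      norm_num
    · simp only [auxInd, hi, if_false, Finset.mem_univ, true_and, iff_false]
      norm_num
  have h4 := h2 (1/2)
  rw [e] at h4
  rw [h3, ← h4]
  simp [auxInd]

/-- Jensen type inequality. -/
theorem aux_jensen {n : ℕ} (h : Finset (Fin n) → ℝ)
    (hs : ∀ S T : Finset (Fin n), h (S ∩ T) + h (S ∪ T) ≤ h S + h T)
    (p : Finset (Fin n) → ℝ) (hp : p ∈ stdSimplex ℝ (Finset (Fin n))) (x : Fin n → ℝ)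
    (hxp : x = fun i => ∑ S, p S * auxInd S i) (hx : x ∈ Set.Icc (0 : Fin n → ℝ) 1) :
    ∫ τ in (0:ℝ)..1, h (Finset.univ.filter fun i => τ < x i) ≤ ∑ S, p S * h S := by
  obtain ⟨w, h1, -, h3⟩ := aux_main h hs x hx
  rw [h3]
  calc h ∅ + ∑ i, w i * x i = ∑ S, p S * (h ∅ + ∑ i ∈ S, w i) := by
        simp_rw [mul_add, Finset.sum_add_distrib, ← Finset.sum_mul, hp.2, one_mul, hxp,
          Finset.mul_sum]
        rw [Finset.sum_comm]
        congr 1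
        refine Finset.sum_congr rfl fun S _ => ?_
        rw [← Finset.sum_filter_add_sum_filter_not Finset.univ (fun i => i ∈ S)]
        rw [Finset.sum_eq_zero (s := Finset.univ.filter fun i => i ∉ S)]
        · rw [add_zero, Finset.filter_univ_mem]
          refine Finset.sum_congr rfl fun i hi => ?_
          simp [auxInd, hi, mul_comm]
        · intro i hi
          simp at hi
          simp [auxInd, hi]
    _ ≤ _ := Finset.sum_le_sum fun S _ => mul_le_mul_of_nonneg_left (h1 S) (hp.1 S)

/-- Suppose `f : 2^{[n]} × ℝ^m → ℝ` is submodular in its first variable and concave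
in its second variable, `f^L` is its Lovász extension in the first variable,
`Y ⊂ ℝ^m` is nonempty, convex and compact, and `ζ(x) = max_{y∈Y} f^L(x,y)`.
If `ζ` is itself the Lovász extension of a submodular set function, then
`min_{x∈[0,1]^n} ζ(x) = min_{x∈{0,1}^n} ζ(x)`, and consequently
`max_{y∈Y} min_{S⊆[n]} f(S,y) = min_{S⊆[n]} max_{y∈Y} f(S,y)` and a saddle point
of `f` exists. -/
theorem saddle_of_zeta_lovasz (n m : ℕ)
    (f : Finset (Fin n) → EuclideanSpace ℝ (Fin m) → ℝ)
    (hsub : ∀ y, ∀ S T : Finset (Fin n), f (S ∩ T) y + f (S ∪ T) y ≤ f S y + f T y)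
    (hconc : ∀ S : Finset (Fin n), ConcaveOn ℝ Set.univ (f S))
    (Y : Set (EuclideanSpace ℝ (Fin m))) (hY : Y.Nonempty)
    (hYconv : Convex ℝ Y) (hYc : IsCompact Y)
    (hζ : ∃ g : Finset (Fin n) → ℝ,
        (∀ S T : Finset (Fin n), g (S ∩ T) + g (S ∪ T) ≤ g S + g T) ∧
        ∀ x ∈ Set.Icc (0 : Fin n → ℝ) 1,
          sSup ((fun y => lovasz f x y) '' Y)
            = ∫ τ in (0:ℝ)..1, g (Finset.univ.filter fun i => τ < x i)) :
    (sInf ((fun x => sSup ((fun y => lovasz f x y) '' Y)) '' Set.Icc (0 : Fin n → ℝ) 1)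
        = sInf ((fun x => sSup ((fun y => lovasz f x y) '' Y)) '' vertices n))
    ∧ (sSup ((fun y => (Finset.univ : Finset (Finset (Fin n))).inf'
            Finset.univ_nonempty (fun S => f S y)) '' Y)
        = (Finset.univ : Finset (Finset (Fin n))).inf'
            Finset.univ_nonempty (fun S => sSup ((fun y => f S y) '' Y)))
    ∧ (∃ Ss : Finset (Fin n), ∃ ys ∈ Y, ∀ S : Finset (Fin n), ∀ y ∈ Y,
        f Ss y ≤ f Ss ys ∧ f Ss ys ≤ f S ys) := by
  classical
  obtain ⟨g, hg, hgz⟩ := hζ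
  have hcont : ∀ S, Continuous (f S) := fun S =>
    continuousOn_univ.mp ((hconc S).continuousOn isOpen_univ)
  have hbdd : ∀ S, BddAbove ((fun y => f S y) '' Y) := fun S =>
    hYc.bddAbove_image (hcont S).continuousOn
  have hindI : ∀ S : Finset (Fin n), auxInd S ∈ Set.Icc (0 : Fin n → ℝ) 1 := by
    intro S
    constructor <;> intro i <;> simp only [auxInd] <;> split_ifs <;> simp
  have hindV : ∀ S : Finset (Fin n), auxInd S ∈ vertices n := by
    intro S i
    simp only [auxInd]; split_ifs <;> simp
  have hVind : ∀ x ∈ vertices n, ∃ S, x = auxInd S := by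
    intro x hx
    refine ⟨Finset.univ.filter fun i => x i = 1, ?_⟩
    ext i
    rcases hx i with h | h <;> simp [auxInd, h]
  have hgS : ∀ S, sSup ((fun y => f S y) '' Y) = g S := by
    intro S
    have h1 := hgz _ (hindI S)
    rw [aux_vertex g hg S] at h1
    rw [← h1]
    congr 1
    refine Set.image_congr fun y _ => ?_
    exact (aux_vertex (fun S => f S y) (hsub y) S).symm
  obtain ⟨S0, -, hS0⟩ := Finset.exists_min_image (Finset.univ : Finset (Finset (Fin n))) g
    Finset.univ_nonempty
  have hS0' : ∀ S, g S0 ≤ g S := fun S => hS0 S (Finset.mem_univ _)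
  have hζlow : ∀ x ∈ Set.Icc (0 : Fin n → ℝ) 1, g S0 ≤ sSup ((fun y => lovasz f x y) '' Y) := by
    intro x hx
    rw [hgz x hx]
    exact aux_lower g hg x _ hS0'
  have hζS0 : sSup ((fun y => lovasz f (auxInd S0) y) '' Y) = g S0 := by
    rw [hgz _ (hindI S0)]
    exact aux_vertex g hg S0
  have hVI : vertices n ⊆ Set.Icc (0 : Fin n → ℝ) 1 := by
    intro x hx
    obtain ⟨S, rfl⟩ := hVind x hx
    exact hindI S
  have hsaddle : ∃ ys ∈ Y, ∀ S, g S0 ≤ f S ys := by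
    obtain ⟨p, hp, ys, hys, hsad⟩ := Sion.exists_isSaddlePointOn
      (X := stdSimplex ℝ (Finset (Fin n))) (Y := Y)
      (f := fun p y => ∑ S, p S * f S y)
      ⟨_, single_mem_stdSimplex ℝ (∅ : Finset (Fin n))⟩ (convex_stdSimplex ℝ _)
      (isCompact_stdSimplex ℝ _)
      (fun y _ => Continuous.lowerSemicontinuous (by fun_prop) |>.lowerSemicontinuousOn _)
      (fun y _ => by
        apply ConvexOn.quasiconvexOn
        refine ⟨convex_stdSimplex ℝ _, ?_⟩
        intro p _ q _ a b _ _ _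
        apply le_of_eq
        simp only [Pi.add_apply, Pi.smul_apply, smul_eq_mul, Finset.mul_sum,
          ← Finset.sum_add_distrib]
        exact Finset.sum_congr rfl fun S _ => by ring)
      hYconv hY hYc
      (fun p _ => Continuous.upperSemicontinuous
        (continuous_finsetSum _ fun S _ => continuous_const.mul (hcont S))
          |>.upperSemicontinuousOn _)
      (fun p hp => by
        apply ConcaveOn.quasiconcaveOn
        refine ⟨hYconv, ?_⟩
        intro y _ z _ a b ha hb hab
        simp only [smul_eq_mul, Finset.mul_sum, ← Finset.sum_add_distrib]
        refine Finset.sum_le_sum fun S _ => ?_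
        have h1 := (hconc S).2 (Set.mem_univ y) (Set.mem_univ z) ha hb hab
        have h2 := mul_le_mul_of_nonneg_left h1 (hp.1 S)
        simp only [smul_eq_mul] at h2
        linarith)
    refine ⟨ys, hys, fun S => ?_⟩
    let x : Fin n → ℝ := fun i => ∑ S, p S * auxInd S i
    have hx : x ∈ Set.Icc (0 : Fin n → ℝ) 1 := by
      constructor <;> intro i
      · exact Finset.sum_nonneg fun S _ => mul_nonneg (hp.1 S) ((hindI S).1 i)
      · have : ∑ S, p S * auxInd S i ≤ ∑ S, p S :=
          Finset.sum_le_sum fun S _ => mul_le_of_le_one_right (hp.1 S) ((hindI S).2 i)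
        rw [hp.2] at this
        exact this
    refine (hζlow x hx).trans (csSup_le (hY.image _) ?_)
    rintro _ ⟨y, hy, rfl⟩
    refine (aux_jensen (fun S => f S y) (hsub y) p hp x rfl hx).trans ?_
    have := hsad _ (single_mem_stdSimplex ℝ S) y hy
    simpa [Pi.single_apply] using this
  obtain ⟨ys, hys, hsad⟩ := hsaddle
  have hle : ∀ S, ∀ y ∈ Y, f S y ≤ g S := fun S y hy => by
    rw [← hgS S]
    exact le_csSup (hbdd S) ⟨y, hy, rfl⟩
  refine ⟨?_, ?_, S0, ys, hys, fun S y hy =>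
    ⟨(hle S0 y hy).trans (hsad S0), (hle S0 ys hys).trans (hsad S)⟩⟩
  · have e1 : IsLeast ((fun x => sSup ((fun y => lovasz f x y) '' Y)) ''
        Set.Icc (0 : Fin n → ℝ) 1) (g S0) :=
      ⟨⟨_, hindI S0, hζS0⟩, by rintro _ ⟨x, hx, rfl⟩; exact hζlow x hx⟩
    have e2 : IsLeast ((fun x => sSup ((fun y => lovasz f x y) '' Y)) '' vertices n) (g S0) :=
      ⟨⟨_, hindV S0, hζS0⟩, by rintro _ ⟨x, hx, rfl⟩; exact hζlow x (hVI hx)⟩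
    rw [e1.csInf_eq, e2.csInf_eq]
  · simp_rw [hgS]
    have e1 : (Finset.univ : Finset (Finset (Fin n))).inf' Finset.univ_nonempty (fun S => g S)
        = g S0 :=
      le_antisymm (Finset.inf'_le _ (Finset.mem_univ _)) (Finset.le_inf' _ _ hS0)
    rw [e1]
    refine IsGreatest.csSup_eq ⟨⟨ys, hys, ?_⟩, ?_⟩
    · refine le_antisymm ?_ (Finset.le_inf' _ _ fun S _ => hsad S)
      exact (Finset.inf'_le _ (Finset.mem_univ S0)).trans (hle S0 ys hys)
    · rintro _ ⟨y, hy, rfl⟩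
      exact (Finset.inf'_le _ (Finset.mem_univ S0)).trans (hle S0 y hy)
end

section
/- Let f : 2^{[n]} × ℝ^m → ℝ be submodular with respect to its first variable and concave with respect to its second variable, let f^L(x,y) = ∫₀¹ f(S_τ(x), y) dτ be its Lovász extension in the first variable, let Y ⊂ ℝ^m be a nonempty convex compact set, and set ζ(x) = max_{y ∈ Y} f^L(x,y) for x ∈ [0,1]^n. If the set of minimisers of ζ over [0,1]^n contains a vertex of the hypercube, i.e., there exists v ∈ {0,1}^n with ζ(v) = min_{x ∈ [0,1]^n} ζ(x), then max_{y ∈ Y} min_{S ⊆ [n]} f(S,y) = min_{S ⊆ [n]} max_{y ∈ Y} f(S,y), so a saddle point of f exists. -/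
open MeasureTheory Finset

/-- Edmonds greedy vector. -/
theorem greedy_aux {n : ℕ} (g : Finset (Fin n) → ℝ)
    (hg : ∀ S T : Finset (Fin n), g (S ∩ T) + g (S ∪ T) ≤ g S + g T) (x : Fin n → ℝ) :
    ∃ w : Fin n → ℝ, (∀ S : Finset (Fin n), g ∅ + ∑ i ∈ S, w i ≤ g S) ∧
      ∀ τ : ℝ, g (Finset.univ.filter fun i => τ < x i)
        = g ∅ + ∑ i ∈ Finset.univ.filter (fun i => τ < x i), w i := by
  obtain ⟨r, hr, hx⟩ : ∃ r : Fin n → Fin n, Function.Injective r ∧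
      ∀ i j, r i ≤ r j → x i ≤ x j := by
    refine ⟨(Tuple.sort x).symm, (Tuple.sort x).symm.injective, fun i j h => ?_⟩
    have := Tuple.monotone_sort x h
    simpa using this
  let w : Fin n → ℝ := fun i => g (Finset.univ.filter fun j => r i ≤ r j)
    - g (Finset.univ.filter fun j => r i < r j)
  refine ⟨w, fun S => ?_, fun τ => ?_⟩
  · induction S using Finset.induction_on_min_value r with
    | empty => simp
    | insert a s ha hmin ih =>
      rw [Finset.sum_insert ha]
      have h := hg (insert a s) (Finset.univ.filter fun j => r a < r j)
      have h1 : insert a s ∩ (Finset.univ.filter fun j => r a < r j) = s := by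
        ext j
        simp only [Finset.mem_inter, Finset.mem_insert, Finset.mem_filter, Finset.mem_univ,
          true_and]
        constructor
        · rintro ⟨rfl | h, h'⟩
          · exact absurd h' (lt_irrefl _)
          · exact h
        · intro h
          refine ⟨Or.inr h, lt_of_le_of_ne (hmin j h) fun e => ha ?_⟩
          rw [hr e]; exact h
      have h2 : insert a s ∪ (Finset.univ.filter fun j => r a < r j)
          = Finset.univ.filter fun j => r a ≤ r j := by
        ext j
        simp only [Finset.mem_union, Finset.mem_insert, Finset.mem_filter, Finset.mem_univ,
          true_and]
        constructor
        · rintro ((rfl | h) | h)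
          · exact le_rfl
          · exact hmin j h
          · exact h.le
        · intro h
          rcases h.eq_or_lt with h | h
          · exact Or.inl (Or.inl (hr h).symm)
          · exact Or.inr h
      rw [h1, h2] at h
      simp only [w] at ih ⊢
      linarith
  · have key : ∀ S : Finset (Fin n), (∀ i ∈ S, ∀ j, r i ≤ r j → j ∈ S) →
        g S = g ∅ + ∑ i ∈ S, w i := by
      intro S
      induction S using Finset.induction_on_min_value r with
      | empty => simp
      | insert a s ha hmin ih =>
        intro hup
        have h2 : insert a s = Finset.univ.filter fun j => r a ≤ r j := by
          ext j
          simp only [Finset.mem_filter, Finset.mem_univ, true_and]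
          constructor
          · intro h
            rcases Finset.mem_insert.1 h with rfl | h
            · exact le_rfl
            · exact hmin j h
          · intro h
            exact hup a (Finset.mem_insert_self _ _) j h
        have h1 : s = Finset.univ.filter fun j => r a < r j := by
          ext j
          simp only [Finset.mem_filter, Finset.mem_univ, true_and]
          constructor
          · intro h
            refine lt_of_le_of_ne (hmin j h) fun e => ha ?_
            rw [hr e]; exact h
          · intro h
            have := hup a (Finset.mem_insert_self _ _) j h.le
            rcases Finset.mem_insert.1 this with rfl | h'
            · exact absurd h (lt_irrefl _)
            · exact h'
        have hs := ih (by
          intro i hi j hij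
          rw [h1]
          rw [h1] at hi
          simp only [Finset.mem_filter, Finset.mem_univ, true_and] at hi ⊢
          exact hi.trans_le hij)
        have hw : w a = g (insert a s) - g s := by
          simp only [w]
          rw [← h2, ← h1]
        rw [Finset.sum_insert ha, hw]
        linarith
    apply key
    intro i hi j hij
    simp only [Finset.mem_filter, Finset.mem_univ, true_and] at hi ⊢
    exact hi.trans_le (hx i j hij)

theorem step_integrable (a : ℝ) :
    IntervalIntegrable (fun τ : ℝ => if τ < a then (1:ℝ) else 0) volume 0 1 := by
  have : (fun τ : ℝ => if τ < a then (1:ℝ) else 0) = (Set.Iio a).indicator fun _ => (1:ℝ) := by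
    ext τ; simp [Set.indicator]
  rw [this, intervalIntegrable_iff, Set.uIoc_of_le zero_le_one]
  exact (integrable_const (1:ℝ)).indicator measurableSet_Iio

theorem step_integral (a : ℝ) (h0 : 0 ≤ a) (h1 : a ≤ 1) :
    ∫ τ in (0:ℝ)..1, (if τ < a then (1:ℝ) else 0) = a := by
  have : (fun τ : ℝ => if τ < a then (1:ℝ) else 0) = (Set.Iio a).indicator fun _ => (1:ℝ) := by
    ext τ; simp [Set.indicator]
  rw [this, intervalIntegral.integral_of_le zero_le_one, integral_indicator measurableSet_Iio,
    Measure.restrict_restrict measurableSet_Iio]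
  have : Set.Iio a ∩ Set.Ioc (0:ℝ) 1 = Set.Ioo 0 a := by
    ext τ
    simp only [Set.mem_inter_iff, Set.mem_Iio, Set.mem_Ioc, Set.mem_Ioo]
    constructor
    · rintro ⟨h, h', _⟩; exact ⟨h', h⟩
    · rintro ⟨h, h'⟩; exact ⟨h', h, by linarith⟩
  rw [this]
  simp [h0]

theorem lovasz_greedy {n : ℕ} {α : Type*} (f : Finset (Fin n) → α → ℝ) (y : α)
    (hg : ∀ S T : Finset (Fin n), f (S ∩ T) y + f (S ∪ T) y ≤ f S y + f T y) (x : Fin n → ℝ)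
    (hx : x ∈ Set.Icc (0 : Fin n → ℝ) 1) :
    ∃ w : Fin n → ℝ, (∀ S : Finset (Fin n), f ∅ y + ∑ i ∈ S, w i ≤ f S y) ∧
      (∀ τ : ℝ, f (Finset.univ.filter fun i => τ < x i) y
        = f ∅ y + ∑ i ∈ Finset.univ.filter (fun i => τ < x i), w i) ∧
      IntervalIntegrable (fun τ : ℝ => f (Finset.univ.filter fun i => τ < x i) y) volume 0 1 ∧
      lovasz f x y = f ∅ y + ∑ i, w i * x i := by
  obtain ⟨w, h1, h2⟩ := greedy_aux (fun S => f S y) hg x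
  have e : (fun τ : ℝ => f (Finset.univ.filter fun i => τ < x i) y)
      = fun τ => f ∅ y + ∑ i, w i * (if τ < x i then (1:ℝ) else 0) := by
    ext τ
    rw [h2 τ, Finset.sum_filter]
    simp
  have hi : ∀ i ∈ (Finset.univ : Finset (Fin n)),
      IntervalIntegrable (fun τ : ℝ => w i * (if τ < x i then (1:ℝ) else 0)) volume 0 1 :=
    fun i _ => (step_integrable (x i)).const_mul _
  have hs : IntervalIntegrable
      (fun τ : ℝ => ∑ i, w i * (if τ < x i then (1:ℝ) else 0)) volume 0 1 := by
    have := IntervalIntegrable.sum Finset.univ hi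
    simpa [Finset.sum_fn] using this
  refine ⟨w, h1, h2, ?_, ?_⟩
  · rw [e]
    exact intervalIntegrable_const.add hs
  · unfold lovasz
    rw [e, intervalIntegral.integral_add intervalIntegrable_const hs,
      intervalIntegral.integral_finsetSum hi]
    simp only [intervalIntegral.integral_const_mul]
    simp only [step_integral _ (hx.1 _) (hx.2 _)]
    simp

theorem lovasz_le_mix {n : ℕ} {α : Type*} (f : Finset (Fin n) → α → ℝ) (y : α)
    (hg : ∀ S T : Finset (Fin n), f (S ∩ T) y + f (S ∪ T) y ≤ f S y + f T y)
    (l : Finset (Fin n) → ℝ) (hl : l ∈ stdSimplex ℝ (Finset (Fin n)))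
    (hx : (fun i => ∑ S, if i ∈ S then l S else 0) ∈ Set.Icc (0 : Fin n → ℝ) 1) :
    lovasz f (fun i => ∑ S, if i ∈ S then l S else 0) y ≤ ∑ S, l S * f S y := by
  obtain ⟨w, h1, -, -, h4⟩ := lovasz_greedy f y hg _ hx
  rw [h4]
  have : f ∅ y + ∑ i, w i * (∑ S : Finset (Fin n), if i ∈ S then l S else 0)
      = ∑ S, l S * (f ∅ y + ∑ i ∈ S, w i) := by
    simp only [mul_add, Finset.sum_add_distrib, ← Finset.sum_mul, hl.2, one_mul,
      Finset.mul_sum]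
    rw [Finset.sum_comm]
    congr 1
    apply Finset.sum_congr rfl
    intro S _
    simp only [mul_ite, mul_zero]
    rw [← Finset.sum_filter]
    simp [mul_comm]
  rw [this]
  exact Finset.sum_le_sum fun S _ => mul_le_mul_of_nonneg_left (h1 S) (hl.1 S)

/-- Suppose `f : 2^{[n]} × ℝ^m → ℝ` is submodular in its first variable and concave
in its second variable, `f^L` is its Lovász extension in the first variable,
`Y ⊂ ℝ^m` is nonempty, convex and compact, and `ζ(x) = max_{y∈Y} f^L(x,y)`.
If the set of minimisers of `ζ` over `[0,1]^n` contains a vertex of the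
hypercube, then `max_{y∈Y} min_{S⊆[n]} f(S,y) = min_{S⊆[n]} max_{y∈Y} f(S,y)` and
a saddle point of `f` exists. -/
theorem saddle_of_vertex_minimiser (n m : ℕ)
    (f : Finset (Fin n) → EuclideanSpace ℝ (Fin m) → ℝ)
    (hsub : ∀ y, ∀ S T : Finset (Fin n), f (S ∩ T) y + f (S ∪ T) y ≤ f S y + f T y)
    (hconc : ∀ S : Finset (Fin n), ConcaveOn ℝ Set.univ (f S))
    (Y : Set (EuclideanSpace ℝ (Fin m))) (hY : Y.Nonempty)
    (hYconv : Convex ℝ Y) (hYc : IsCompact Y)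
    (hvtx : ∃ v ∈ vertices n,
        sSup ((fun y => lovasz f v y) '' Y)
          = sInf ((fun x => sSup ((fun y => lovasz f x y) '' Y)) '' Set.Icc (0 : Fin n → ℝ) 1)) :
    (sSup ((fun y => (Finset.univ : Finset (Finset (Fin n))).inf'
            Finset.univ_nonempty (fun S => f S y)) '' Y)
        = (Finset.univ : Finset (Finset (Fin n))).inf'
            Finset.univ_nonempty (fun S => sSup ((fun y => f S y) '' Y)))
    ∧ (∃ Ss : Finset (Fin n), ∃ ys ∈ Y, ∀ S : Finset (Fin n), ∀ y ∈ Y,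
        f Ss y ≤ f Ss ys ∧ f Ss ys ≤ f S ys) := by
  classical
  have hcont : ∀ S, Continuous (f S) := fun S =>
    continuousOn_univ.1 ((hconc S).continuousOn isOpen_univ)
  obtain ⟨l, hl, ys, hys, hsad⟩ : ∃ a ∈ stdSimplex ℝ (Finset (Fin n)), ∃ b ∈ Y,
      IsSaddlePointOn (stdSimplex ℝ (Finset (Fin n))) Y
        (fun l y => ∑ S, l S * f S y) a b := by
    refine Sion.exists_isSaddlePointOn' (X := stdSimplex ℝ (Finset (Fin n))) (Y := Y)
      (ne_X := ⟨_, single_mem_stdSimplex ℝ ∅⟩) (kX := isCompact_stdSimplex ℝ _)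
      (hfy := ?_) (hfy' := ?_) (cY := hYconv) (hfx := ?_) (hfx' := ?_)
      (cX := convex_stdSimplex ℝ _) (ne_Y := hY) (kY := hYc)
    · intro y _
      exact (Continuous.lowerSemicontinuous (by fun_prop)).lowerSemicontinuousOn _
    · intro y _
      apply ConvexOn.quasiconvexOn
      refine ⟨convex_stdSimplex ℝ _, fun a _ b _ s t _ _ _ => le_of_eq ?_⟩
      simp only [Pi.add_apply, Pi.smul_apply, smul_eq_mul, Finset.mul_sum,
        ← Finset.sum_add_distrib]
      exact Finset.sum_congr rfl fun S _ => by ring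
    · intro l _
      exact (Continuous.upperSemicontinuous
        (continuous_finsetSum _ fun S _ => continuous_const.mul (hcont S))).upperSemicontinuousOn _
    · intro l hl
      apply ConcaveOn.quasiconcaveOn
      refine ⟨hYconv, fun a _ b _ s t hs ht hst => ?_⟩
      simp only [smul_eq_mul, Finset.mul_sum, ← Finset.sum_add_distrib]
      refine Finset.sum_le_sum fun S _ => ?_
      have := (hconc S).2 (Set.mem_univ a) (Set.mem_univ b) hs ht hst
      simp only [smul_eq_mul] at this
      have := mul_le_mul_of_nonneg_left this (hl.1 S)
      linarith
  have hmix : ∀ S, ∀ y ∈ Y, ∑ T, l T * f T y ≤ f S ys := by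
    intro S y hy
    have := hsad _ (single_mem_stdSimplex ℝ S) y hy
    simpa [Pi.single_apply] using this
  -- upper bound on `Y`
  have hbdd : ∀ S, BddAbove ((fun y => f S y) '' Y) := fun S =>
    hYc.bddAbove_image (hcont S).continuousOn
  obtain ⟨C, hC⟩ : ∃ C, ∀ S, ∀ y ∈ Y, f S y ≤ C := by
    choose c hc using hbdd
    refine ⟨Finset.univ.sup' Finset.univ_nonempty c, fun S y hy => ?_⟩
    exact (hc S ⟨y, hy, rfl⟩).trans (Finset.le_sup' c (Finset.mem_univ S))
  have hLub : ∀ x ∈ Set.Icc (0 : Fin n → ℝ) 1, BddAbove ((fun y => lovasz f x y) '' Y) := by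
    rintro x hx
    refine ⟨C, ?_⟩
    rintro _ ⟨y, hy, rfl⟩
    obtain ⟨w, -, -, h3, -⟩ := lovasz_greedy f y (hsub y) x hx
    have := intervalIntegral.integral_mono (μ := volume) (zero_le_one) h3
      (intervalIntegrable_const (c := C)) (fun τ => hC _ y hy)
    simpa [lovasz] using this
  have hbelow : BddBelow ((fun x => sSup ((fun y => lovasz f x y) '' Y)) ''
      Set.Icc (0 : Fin n → ℝ) 1) := by
    obtain ⟨y, hy⟩ := hY
    refine ⟨Finset.univ.inf' Finset.univ_nonempty (fun S => f S y), ?_⟩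
    rintro _ ⟨x, hx, rfl⟩
    refine le_trans ?_ (le_csSup (hLub x hx) ⟨y, hy, rfl⟩)
    obtain ⟨w, -, -, h3, -⟩ := lovasz_greedy f y (hsub y) x hx
    have := intervalIntegral.integral_mono (μ := volume) (zero_le_one)
      (intervalIntegrable_const (c := Finset.univ.inf' Finset.univ_nonempty (fun S => f S y))) h3
      (fun τ => Finset.inf'_le (fun S => f S y) (Finset.mem_univ _))
    rw [intervalIntegral.integral_const, sub_zero, one_smul] at this
    exact this
  obtain ⟨v, hv, hmin⟩ := hvtx
  have hvI : v ∈ Set.Icc (0 : Fin n → ℝ) 1 := by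
    constructor <;> intro i <;> rcases hv i with h | h <;> simp [h]
  set V : Finset (Fin n) := Finset.univ.filter fun i => (1/2 : ℝ) < v i with hV
  have hLv : ∀ y, lovasz f v y = f V y := by
    intro y
    obtain ⟨w, -, h2, -, h4⟩ := lovasz_greedy f y (hsub y) v hvI
    rw [h4, hV, h2, Finset.sum_filter]
    congr 1
    refine Finset.sum_congr rfl fun i _ => ?_
    rcases hv i with h | h <;> rw [h] <;> norm_num
  have hxI : (fun i => ∑ S, if i ∈ S then l S else 0) ∈ Set.Icc (0 : Fin n → ℝ) 1 := by
    constructor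
    · intro i
      exact Finset.sum_nonneg fun S _ => by split_ifs; exacts [hl.1 S, le_rfl]
    · intro i
      show (∑ S, if i ∈ S then l S else 0) ≤ 1
      rw [← hl.2]
      exact Finset.sum_le_sum fun S _ => by split_ifs; exacts [le_rfl, hl.1 S]
  have main : ∀ S, ∀ y ∈ Y, f V y ≤ f S ys := by
    intro S y hy
    rw [← hLv y]
    refine (le_csSup (hLub v hvI) ⟨y, hy, rfl⟩).trans ?_
    rw [hmin]
    refine (csInf_le hbelow ⟨_, hxI, rfl⟩).trans ?_
    refine csSup_le (hY.image _) ?_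
    rintro _ ⟨z, hz, rfl⟩
    exact (lovasz_le_mix f z (hsub z) l hl hxI).trans (hmix S z hz)
  refine ⟨le_antisymm ?_ ?_, V, ys, hys, fun S y hy => ⟨main V y hy, main S ys hys⟩⟩
  · refine csSup_le (hY.image _) ?_
    rintro _ ⟨y, hy, rfl⟩
    refine Finset.le_inf' _ _ fun S _ => ?_
    exact (Finset.inf'_le (fun S => f S y) (Finset.mem_univ S)).trans
      (le_csSup (hbdd S) ⟨y, hy, rfl⟩)
  · refine (Finset.inf'_le _ (Finset.mem_univ V)).trans ?_
    refine le_trans (b := Finset.univ.inf' Finset.univ_nonempty (fun S => f S ys)) ?_ ?_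
    · refine Finset.le_inf' _ _ fun S _ => ?_
      refine csSup_le (hY.image _) ?_
      rintro _ ⟨y, hy, rfl⟩
      exact main S y hy
    · refine le_csSup ⟨C, ?_⟩ ⟨ys, hys, rfl⟩
      rintro _ ⟨y, hy, rfl⟩
      exact (Finset.inf'_le (fun S => f S y) (Finset.mem_univ ∅)).trans (hC ∅ y hy)
end

section
/- Let F, G : ℝ^m → ℝ with F Lipschitz continuous with constant L > 0 and sup_{y∈ℝ^m} |F(y) − G(y)| ≤ V for some V ≥ 0. Fix y ∈ ℝ^m and μ > 0, and for u ∼ N(0, I_m) define the random vector h(u) = ((F(y + μu) − G(y))/μ) u. Then E_u[‖h(u)‖²] ≤ 2 L² (m+4)² + 2 m V²/μ². -/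
open MeasureTheory

/-- The standard Gaussian measure `N(0, I_m)` on `ℝ^m`, with density
`(2π)^{−m/2} e^{−‖u‖²/2}` with respect to the Lebesgue measure. -/
noncomputable def stdGaussian (m : ℕ) : Measure (EuclideanSpace ℝ (Fin m)) :=
  volume.withDensity fun u =>
    ENNReal.ofReal ((2 * Real.pi) ^ (-(m : ℝ) / 2) * Real.exp (-‖u‖ ^ 2 / 2))

theorem aux_radial (q : ℝ) (hq : -1 < q) :
    ∫ x in Set.Ioi (0 : ℝ), x ^ q * Real.exp (-(1/2) * x ^ (2:ℝ)) =
      (1/2 : ℝ) ^ (-(q + 1) / 2) * (1 / 2) * Real.Gamma ((q + 1) / 2) :=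
  integral_rpow_mul_exp_neg_mul_rpow (by norm_num) hq (by norm_num)

theorem aux_radial_rec (q : ℝ) (hq : -1 < q) :
    ∫ x in Set.Ioi (0 : ℝ), x ^ (q + 2) * Real.exp (-(1/2) * x ^ (2:ℝ)) =
      (q + 1) * ∫ x in Set.Ioi (0 : ℝ), x ^ q * Real.exp (-(1/2) * x ^ (2:ℝ)) := by
  rw [aux_radial q hq, aux_radial (q + 2) (by linarith)]
  have h1 : (q + 2 + 1) / 2 = (q + 1) / 2 + 1 := by ring
  have h2 : -(q + 2 + 1) / 2 = -(q + 1) / 2 - 1 := by ring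
  rw [h1, h2, Real.Gamma_add_one (by linarith), Real.rpow_sub_one (by norm_num)]
  ring

theorem aux_norm (m k : ℕ) :
    ∫ u : EuclideanSpace ℝ (Fin (m + 1)), ‖u‖ ^ k * Real.exp (-(1/2) * ‖u‖ ^ 2) =
      (m + 1 : ℕ) • (volume : Measure (EuclideanSpace ℝ (Fin (m + 1)))).real (Metric.ball 0 1) •
        ∫ x in Set.Ioi (0 : ℝ), x ^ ((m + k : ℕ) : ℝ) * Real.exp (-(1/2) * x ^ (2:ℝ)) := by
  rw [MeasureTheory.integral_fun_norm_addHaar volume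
    (fun x : ℝ => x ^ k * Real.exp (-(1/2) * x ^ 2))]
  simp only [finrank_euclideanSpace, Fintype.card_fin, Nat.add_sub_cancel]
  congr 2
  refine setIntegral_congr_fun measurableSet_Ioi (fun x _ => ?_)
  have : x ^ (2:ℝ) = x ^ (2:ℕ) := by exact_mod_cast Real.rpow_natCast x 2
  simp only [this, Real.rpow_natCast, smul_eq_mul, pow_add, mul_assoc]

theorem aux_rec (m k : ℕ) :
    ∫ u : EuclideanSpace ℝ (Fin (m + 1)), ‖u‖ ^ (k + 2) * Real.exp (-(1/2) * ‖u‖ ^ 2) =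
      (m + 1 + k : ℝ) *
    ∫ u : EuclideanSpace ℝ (Fin (m + 1)), ‖u‖ ^ k * Real.exp (-(1/2) * ‖u‖ ^ 2) := by
  rw [aux_norm, aux_norm]
  have h : ((m + (k + 2) : ℕ) : ℝ) = ((m + k : ℕ) : ℝ) + 2 := by push_cast; ring
  have h0 : (0:ℝ) ≤ ((m + k : ℕ) : ℝ) := Nat.cast_nonneg _
  rw [h, aux_radial_rec _ (by linarith)]
  simp only [nsmul_eq_mul, smul_eq_mul]
  push_cast
  ring

theorem aux_zero (m : ℕ) :
    ∫ u : EuclideanSpace ℝ (Fin m), ‖u‖ ^ 0 * Real.exp (-(1/2) * ‖u‖ ^ 2) =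
      (2 * Real.pi) ^ ((m : ℝ) / 2) := by
  simp only [pow_zero, one_mul]
  rw [GaussianFourier.integral_rexp_neg_mul_sq_norm (by norm_num)]
  simp only [finrank_euclideanSpace, Fintype.card_fin]
  congr 1
  ring

theorem aux_gauss (m : ℕ) (g : EuclideanSpace ℝ (Fin m) → ℝ) :
    ∫ u, g u ∂(stdGaussian m) =
      (2 * Real.pi) ^ (-(m : ℝ) / 2) * ∫ u, g u * Real.exp (-(1/2) * ‖u‖ ^ 2) := by
  unfold stdGaussian
  rw [integral_withDensity_eq_integral_toReal_smul (by fun_prop) (by simp), ← integral_const_mul]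
  congr 1
  ext u
  have h : 0 ≤ (2 * Real.pi) ^ (-(m : ℝ) / 2) * Real.exp (-‖u‖ ^ 2 / 2) := by positivity
  rw [ENNReal.toReal_ofReal h, smul_eq_mul]
  have : -‖u‖ ^ 2 / 2 = -(1/2) * ‖u‖ ^ 2 := by ring
  rw [this]
  ring

theorem aux_const (m : ℕ) :
    (2 * Real.pi) ^ (-(m : ℝ) / 2) * (2 * Real.pi) ^ ((m : ℝ) / 2) = 1 := by
  rw [← Real.rpow_add (by positivity)]
  have : -(m : ℝ) / 2 + (m : ℝ) / 2 = 0 := by ring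
  rw [this, Real.rpow_zero]

theorem aux_m2 (m : ℕ) : ∫ u, ‖u‖ ^ 2 ∂(stdGaussian (m + 1)) = (m + 1 : ℝ) := by
  rw [aux_gauss, aux_rec m 0, aux_zero]
  have := aux_const (m + 1)
  push_cast at this ⊢
  linear_combination (m + 1 : ℝ) * this

theorem aux_m4 (m : ℕ) :
    ∫ u, ‖u‖ ^ 4 ∂(stdGaussian (m + 1)) = (m + 1 : ℝ) * (m + 3) := by
  rw [aux_gauss, aux_rec m 2, aux_rec m 0, aux_zero]
  have := aux_const (m + 1)
  push_cast at this ⊢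
  linear_combination (m + 1 : ℝ) * (m + 3) * this

/-- Second-moment bound for the shifted two-point random oracle: if
`F : ℝ^m → ℝ` is `L`-Lipschitz with `L > 0` and `sup_y |F(y) − G(y)| ≤ V` for
some `V ≥ 0`, then for fixed `y ∈ ℝ^m` and `μ > 0`, the random vector
`h(u) = ((F(y+μu) − G(y))/μ) u`, with `u ∼ N(0, I_m)`, satisfies
`E[‖h(u)‖²] ≤ 2 L² (m+4)² + 2 m V²/μ²`. -/
theorem oracle_second_moment_bound (m : ℕ)
    (F G : EuclideanSpace ℝ (Fin m) → ℝ)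
    (L : ℝ) (hL : 0 < L)
    (hF : ∀ y y' : EuclideanSpace ℝ (Fin m), |F y - F y'| ≤ L * ‖y - y'‖)
    (V : ℝ) (hV : 0 ≤ V)
    (hFG : ∀ y : EuclideanSpace ℝ (Fin m), |F y - G y| ≤ V)
    (y : EuclideanSpace ℝ (Fin m)) (μ : ℝ) (hμ : 0 < μ) :
    (∫ u, ‖((F (y + μ • u) - G y) / μ) • u‖ ^ 2 ∂(stdGaussian m))
      ≤ 2 * L ^ 2 * ((m : ℝ) + 4) ^ 2 + 2 * (m : ℝ) * V ^ 2 / μ ^ 2 := by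
  rcases m with _ | m
  · have h0 : ∀ u : EuclideanSpace ℝ (Fin 0), u = 0 := fun u => Subsingleton.elim _ _
    have : ∀ u : EuclideanSpace ℝ (Fin 0), ‖((F (y + μ • u) - G y) / μ) • u‖ ^ 2 = 0 := by
      intro u
      rw [h0 u]
      simp
    simp only [this, integral_zero]
    positivity
  · have i2 : Integrable (fun u => ‖u‖ ^ 2) (stdGaussian (m + 1)) := by
      by_contra h
      have h1 := aux_m2 m
      rw [integral_undef h] at h1
      have : (0:ℝ) < m + 1 := by positivity
      linarith
    have i4 : Integrable (fun u => ‖u‖ ^ 4) (stdGaussian (m + 1)) := by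
      by_contra h
      have h1 := aux_m4 m
      rw [integral_undef h] at h1
      have : (0:ℝ) < (m + 1) * (m + 3) := by positivity
      linarith
    have key : ∀ u : EuclideanSpace ℝ (Fin (m + 1)),
        ‖((F (y + μ • u) - G y) / μ) • u‖ ^ 2 ≤
          2 * L ^ 2 * ‖u‖ ^ 4 + 2 * V ^ 2 / μ ^ 2 * ‖u‖ ^ 2 := by
      intro u
      have h1 := hF (y + μ • u) y
      have h2 := hFG y
      rw [add_sub_cancel_left, norm_smul, Real.norm_of_nonneg hμ.le] at h1
      have h3 : (F (y + μ • u) - F y) ^ 2 ≤ (L * (μ * ‖u‖)) ^ 2 :=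
        sq_le_sq' (abs_le.1 h1).1 (abs_le.1 h1).2
      have h4 : (F y - G y) ^ 2 ≤ V ^ 2 := sq_le_sq' (abs_le.1 h2).1 (abs_le.1 h2).2
      have h5 : (F (y + μ • u) - G y) ^ 2 ≤ 2 * (L * (μ * ‖u‖)) ^ 2 + 2 * V ^ 2 := by
        nlinarith [sq_nonneg ((F (y + μ • u) - F y) - (F y - G y))]
      rw [norm_smul, mul_pow, Real.norm_eq_abs, sq_abs, div_pow]
      calc (F (y + μ • u) - G y) ^ 2 / μ ^ 2 * ‖u‖ ^ 2
          ≤ (2 * (L * (μ * ‖u‖)) ^ 2 + 2 * V ^ 2) / μ ^ 2 * ‖u‖ ^ 2 := by gcongr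
        _ = _ := by
          field_simp
    have hle := integral_mono_of_nonneg (μ := stdGaussian (m + 1))
      (Filter.Eventually.of_forall fun u => by positivity)
      ((i4.const_mul (2 * L ^ 2)).add (i2.const_mul (2 * V ^ 2 / μ ^ 2)))
      (Filter.Eventually.of_forall key)
    refine hle.trans ?_
    simp only [Pi.add_apply]
    rw [integral_add (i4.const_mul _) (i2.const_mul _), integral_const_mul, integral_const_mul,
      aux_m2, aux_m4]
    push_cast
    have h6 : 2 * L ^ 2 * ((m + 1 : ℝ) * (m + 3)) ≤ 2 * L ^ 2 * ((m : ℝ) + 1 + 4) ^ 2 := by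
      have : (0:ℝ) ≤ m := Nat.cast_nonneg m
      gcongr
      nlinarith
    have h7 : 2 * V ^ 2 / μ ^ 2 * (m + 1 : ℝ) = 2 * ((m : ℝ) + 1) * V ^ 2 / μ ^ 2 := by ring
    linarith
end
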